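/- arXiv:1606.04571 — 2 statements merged into one kernel-verified Lean document; each statement's English description precedes it below -/
import Mathlib

section
/- Let k ≥ 1 and let α_0, …, α_{k−1} be real numbers with |α_j| < 1. Let Φ_k, Φ_k*, Ψ_k, Ψ_k* be the polynomials generated by the Szegő recursion from the parameters (α_j)_{j=0}^{k−1}. Define a new parameter sequence (γ_j)_{j=0}^{2k−1} by γ_j = α_j for 0 ≤ j ≤ k−1 and γ_j = −α_{2k−1−j} for k ≤ j ≤ 2k−1, and let Φ_{2k}, Φ_{2k}* be the polynomials generated by the Szegő recursion from (γ_j). Then the following polynomial identities hold: 2z·Φ_{2k}(z) = z·Φ_k(z)² + z·Φ_k(z)Ψ_k(z) − Φ_k*(z)² + Φ_k*(z)Ψ_k*(z) (equivalently 2Φ_{2k} = Φ_k² + Φ_kΨ_k − z^{−1}(Φ_k*)² + z^{−1}Φ_k*Ψ_k*), and 2Φ_{2k}*(z) = Φ_k*(z)² + Φ_k*(z)Ψ_k*(z) − z·Φ_k(z)² + z·Φ_k(z)Ψ_k(z). -/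
open Complex

noncomputable def szegoRec (γ : ℕ → ℂ) : ℕ → (ℂ → ℂ) × (ℂ → ℂ)
  | 0 => (fun _ => 1, fun _ => 1)
  | n + 1 =>
    (fun z => z * (szegoRec γ n).1 z - (starRingEnd ℂ) (γ n) * (szegoRec γ n).2 z,
     fun z => (szegoRec γ n).2 z - γ n * z * (szegoRec γ n).1 z)

noncomputable def szegoPhi (γ : ℕ → ℂ) (n : ℕ) : ℂ → ℂ := (szegoRec γ n).1
noncomputable def szegoPhiStar (γ : ℕ → ℂ) (n : ℕ) : ℂ → ℂ := (szegoRec γ n).2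
noncomputable def szegoPsi (γ : ℕ → ℂ) (n : ℕ) : ℂ → ℂ := (szegoRec (fun j => -γ j) n).1
noncomputable def szegoPsiStar (γ : ℕ → ℂ) (n : ℕ) : ℂ → ℂ := (szegoRec (fun j => -γ j) n).2

theorem szegoRec_congr {γ δ : ℕ → ℂ} {n : ℕ} (h : ∀ j < n, γ j = δ j) :
    szegoRec γ n = szegoRec δ n := by
  induction n with
  | zero => rfl
  | succ n ih =>
    simp only [szegoRec, ih fun j hj => h j (hj.trans n.lt_succ_self), h n n.lt_succ_self]

/-- Undoing the last `j` steps of the recursion, when the corresponding last `j` parameters are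
the negatives of the real numbers `α (j - 1), …, α 0`. -/
theorem two_mul_szegoRec_add (α : ℕ → ℝ) (γ : ℕ → ℂ) (z : ℂ) (j : ℕ) :
    ∀ m : ℕ, (∀ i < j, γ (m + (j - 1 - i)) = -(α i : ℂ)) →
      2 * z * szegoPhi γ (m + j) z =
        (szegoPsi (fun i => (α i : ℂ)) j z + szegoPhi (fun i => (α i : ℂ)) j z)
            * (z * szegoPhi γ m z)
          + (szegoPsiStar (fun i => (α i : ℂ)) j z - szegoPhiStar (fun i => (α i : ℂ)) j z)
            * szegoPhiStar γ m z ∧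
      2 * szegoPhiStar γ (m + j) z =
        (szegoPsi (fun i => (α i : ℂ)) j z - szegoPhi (fun i => (α i : ℂ)) j z)
            * (z * szegoPhi γ m z)
          + (szegoPsiStar (fun i => (α i : ℂ)) j z + szegoPhiStar (fun i => (α i : ℂ)) j z)
            * szegoPhiStar γ m z := by
  induction j with
  | zero =>
    intro m _
    simp only [szegoPhi, szegoPhiStar, szegoPsi, szegoPsiStar, szegoRec, Nat.add_zero]
    constructor <;> ring
  | succ j ih =>
    intro m h
    have hm : γ m = -(α j : ℂ) := by simpa using h j j.lt_succ_self
    obtain ⟨h1, h2⟩ := ih (m + 1) fun i hi => by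
      rw [← h i (by omega)]
      congr 1
      omega
    rw [show m + (j + 1) = m + 1 + j by omega, h1, h2]
    simp only [szegoPhi, szegoPhiStar, szegoPsi, szegoPsiStar, szegoRec, hm, map_neg,
      Complex.conj_ofReal]
    constructor <;> ring

/-- Lemma 2.1: doubling the parameter sequence with an antisymmetric flip. -/
theorem statement1 (k : ℕ) (hk : 1 ≤ k) (α : ℕ → ℝ)
    (hα : ∀ j < k, |α j| < 1)
    (γ : ℕ → ℂ)
    (hγ1 : ∀ j < k, γ j = (α j : ℂ))
    (hγ2 : ∀ j, k ≤ j → j ≤ 2 * k - 1 → γ j = -((α (2 * k - 1 - j) : ℝ) : ℂ)) :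
    ∀ z : ℂ,
      (2 * z * szegoPhi γ (2 * k) z =
        z * (szegoPhi (fun j => (α j : ℂ)) k z) ^ 2
          + z * szegoPhi (fun j => (α j : ℂ)) k z * szegoPsi (fun j => (α j : ℂ)) k z
          - (szegoPhiStar (fun j => (α j : ℂ)) k z) ^ 2
          + szegoPhiStar (fun j => (α j : ℂ)) k z * szegoPsiStar (fun j => (α j : ℂ)) k z)
      ∧
      (2 * szegoPhiStar γ (2 * k) z =
        (szegoPhiStar (fun j => (α j : ℂ)) k z) ^ 2
          + szegoPhiStar (fun j => (α j : ℂ)) k z * szegoPsiStar (fun j => (α j : ℂ)) k z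
          - z * (szegoPhi (fun j => (α j : ℂ)) k z) ^ 2
          + z * szegoPhi (fun j => (α j : ℂ)) k z * szegoPsi (fun j => (α j : ℂ)) k z) := by
  intro z
  obtain ⟨h1, h2⟩ := two_mul_szegoRec_add α γ z k k fun i hi => by
    rw [hγ2 _ (by omega) (by omega)]
    congr 3
    omega
  have hΦ : szegoPhi γ k = szegoPhi (fun j => (α j : ℂ)) k :=
    congrArg Prod.fst (szegoRec_congr hγ1)
  have hΦs : szegoPhiStar γ k = szegoPhiStar (fun j => (α j : ℂ)) k :=
    congrArg Prod.snd (szegoRec_congr hγ1)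
  rw [two_mul k, h1, h2, hΦ, hΦs]
  constructor <;> ring
end

section
/- Let n ≥ 1 and let α_0, …, α_{n−1} be real numbers with |α_j| < 1, and let Φ_n, Φ_n*, Ψ_n, Ψ_n* be the polynomials generated by the Szegő recursion from (α_j)_{j=0}^{n−1}. Define the parameter sequence (γ_j)_{j=0}^{2n} by γ_j = α_j for 0 ≤ j ≤ n−1, γ_j = −α_{2n−1−j} for n ≤ j ≤ 2n−1, and γ_{2n} = 0, and let Φ_{2n+1}, Φ_{2n+1}* be the polynomials generated by the Szegő recursion from (γ_j). Then 2Φ_{2n+1}(z) = z·Φ_n(z)² + z·Φ_n(z)Ψ_n(z) − Φ_n*(z)² + Φ_n*(z)Ψ_n*(z) and 2Φ_{2n+1}*(z) = Φ_n*(z)² + Φ_n*(z)Ψ_n*(z) − z·Φ_n(z)² + z·Φ_n(z)Ψ_n(z), as identities of polynomials. -/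
open Complex

theorem szegoPhi_succ (γ : ℕ → ℂ) (n : ℕ) (z : ℂ) :
    szegoPhi γ (n + 1) z = z * szegoPhi γ n z - (starRingEnd ℂ) (γ n) * szegoPhiStar γ n z :=
  rfl

theorem szegoPhiStar_succ (γ : ℕ → ℂ) (n : ℕ) (z : ℂ) :
    szegoPhiStar γ (n + 1) z = szegoPhiStar γ n z - γ n * z * szegoPhi γ n z :=
  rfl

theorem szegoPsi_succ (γ : ℕ → ℂ) (n : ℕ) (z : ℂ) :
    szegoPsi γ (n + 1) z = z * szegoPsi γ n z + (starRingEnd ℂ) (γ n) * szegoPsiStar γ n z := by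
  change z * szegoPsi γ n z - (starRingEnd ℂ) (-γ n) * szegoPsiStar γ n z = _
  rw [map_neg]
  ring

theorem szegoPsiStar_succ (γ : ℕ → ℂ) (n : ℕ) (z : ℂ) :
    szegoPsiStar γ (n + 1) z = szegoPsiStar γ n z + γ n * z * szegoPsi γ n z := by
  change szegoPsiStar γ n z - -γ n * z * szegoPsi γ n z = _
  ring

/-- If the parameters `γ` between `N - k` and `N` are the negated, reversed initial real parameters
`α`, then these two bilinear pairings of the polynomials of degree `k` for `α` with those of
degree `N - k` for `γ` do not depend on `k`. -/
theorem szego_pairing_of_antisymm_flip {α : ℕ → ℝ} {γ : ℕ → ℂ} {N : ℕ} (z : ℂ) {k m : ℕ}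
    (hN : m + k = N) (h : ∀ j < k, γ (N - 1 - j) = -(α j : ℂ)) :
    z * (szegoPsi (fun j => (α j : ℂ)) k z + szegoPhi (fun j => (α j : ℂ)) k z) * szegoPhi γ m z
        + (szegoPsiStar (fun j => (α j : ℂ)) k z - szegoPhiStar (fun j => (α j : ℂ)) k z)
          * szegoPhiStar γ m z = 2 * z * szegoPhi γ N z ∧
    z * (szegoPsi (fun j => (α j : ℂ)) k z - szegoPhi (fun j => (α j : ℂ)) k z) * szegoPhi γ m z
        + (szegoPsiStar (fun j => (α j : ℂ)) k z + szegoPhiStar (fun j => (α j : ℂ)) k z)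
          * szegoPhiStar γ m z = 2 * szegoPhiStar γ N z := by
  induction k generalizing m with
  | zero =>
    obtain rfl : m = N := hN
    simp only [szegoPsi, szegoPsiStar, szegoPhi, szegoPhiStar, szegoRec]
    constructor <;> ring
  | succ k ih =>
    obtain ⟨h₁, h₂⟩ := ih (m := m + 1) (by omega) fun j hj => h j (hj.trans k.lt_succ_self)
    have hm : γ m = -(α k : ℂ) := by
      rw [← h k k.lt_succ_self]
      congr 1
      omega
    rw [← h₁, ← h₂]
    simp only [szegoPhi_succ, szegoPhiStar_succ, szegoPsi_succ, szegoPsiStar_succ, hm, map_neg,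
      conj_ofReal]
    constructor <;> ring

/-- Doubling the parameter sequence with an antisymmetric flip followed by a zero
parameter: formulas for `Φ_{2n+1}` and `Φ_{2n+1}*`. -/
theorem statement2 (n : ℕ) (hn : 1 ≤ n) (α : ℕ → ℝ)
    (hα : ∀ j < n, |α j| < 1)
    (γ : ℕ → ℂ)
    (hγ1 : ∀ j < n, γ j = (α j : ℂ))
    (hγ2 : ∀ j, n ≤ j → j ≤ 2 * n - 1 → γ j = -((α (2 * n - 1 - j) : ℝ) : ℂ))
    (hγ3 : γ (2 * n) = 0) :
    ∀ z : ℂ,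
      (2 * szegoPhi γ (2 * n + 1) z =
        z * (szegoPhi (fun j => (α j : ℂ)) n z) ^ 2
          + z * szegoPhi (fun j => (α j : ℂ)) n z * szegoPsi (fun j => (α j : ℂ)) n z
          - (szegoPhiStar (fun j => (α j : ℂ)) n z) ^ 2
          + szegoPhiStar (fun j => (α j : ℂ)) n z * szegoPsiStar (fun j => (α j : ℂ)) n z)
      ∧
      (2 * szegoPhiStar γ (2 * n + 1) z =
        (szegoPhiStar (fun j => (α j : ℂ)) n z) ^ 2
          + szegoPhiStar (fun j => (α j : ℂ)) n z * szegoPsiStar (fun j => (α j : ℂ)) n z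
          - z * (szegoPhi (fun j => (α j : ℂ)) n z) ^ 2
          + z * szegoPhi (fun j => (α j : ℂ)) n z * szegoPsi (fun j => (α j : ℂ)) n z) := by
  intro z
  obtain ⟨h₁, h₂⟩ := szego_pairing_of_antisymm_flip (α := α) (γ := γ) (k := n) z (two_mul n).symm
    fun j hj => by
      rw [hγ2 _ (by omega) (by omega), show 2 * n - 1 - (2 * n - 1 - j) = j by omega]
  have hPhi : szegoPhi γ n = szegoPhi (fun j => (α j : ℂ)) n := by
    simp only [szegoPhi, szegoRec_congr hγ1]
  have hPhiStar : szegoPhiStar γ n = szegoPhiStar (fun j => (α j : ℂ)) n := by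
    simp only [szegoPhiStar, szegoRec_congr hγ1]
  rw [hPhi, hPhiStar] at h₁ h₂
  rw [szegoPhi_succ, szegoPhiStar_succ, hγ3, map_zero]
  constructor
  · linear_combination -h₁
  · linear_combination -h₂
end
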